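/- Truth lemma for SMLKV^r: for every state s of the canonical model M of SMLKV^r and every MLKv^r formula φ, M,s ⊩ φ if and only if φ ∈ s. -/

import Mathlib

/-- A Kripke frame with binary relations `rel i` and ternary relations `relc i c`,
together with a valuation; an MLKv^r model is such a frame satisfying `IsMLKv`. -/
structure KFrame where
  S : Type
  rel : ℕ → S → S → Prop
  relc : ℕ → ℕ → S → S → S → Prop
  val : S → ℕ → Prop

/-- The three frame conditions SYM, INCL and ATEUC of MLKv^r models. -/
def KFrame.IsMLKv (M : KFrame) : Prop :=
  (∀ i c s t u, M.relc i c s t u ↔ M.relc i c s u t) ∧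
  (∀ i c s t u, M.relc i c s t u → M.rel i s t ∧ M.rel i s u) ∧
  (∀ i c s t u v, M.relc i c s t u → M.rel i s v → M.relc i c s t v ∨ M.relc i c s u v)

/-- The language MLKv^r with unary modalities `box i` (□_i) and `boxc i c` (□_i^c). -/
inductive FormM : Type
  | top : FormM
  | atom : ℕ → FormM
  | neg : FormM → FormM
  | and : FormM → FormM → FormM
  | box : ℕ → FormM → FormM
  | boxc : ℕ → ℕ → FormM → FormM

namespace FormM
def imp (φ ψ : FormM) : FormM := neg (and φ (neg ψ))
def or (φ ψ : FormM) : FormM := neg (and (neg φ) (neg ψ))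
def iff (φ ψ : FormM) : FormM := and (imp φ ψ) (imp ψ φ)
def bot : FormM := neg top
def dia (i : ℕ) (φ : FormM) : FormM := neg (box i (neg φ))
def diac (i c : ℕ) (φ : FormM) : FormM := neg (boxc i c (neg φ))
end FormM

/-- Satisfaction for MLKv^r formulas; `boxc i c φ` holds at `s` iff every pair of
`relc i c`-successors contains a `φ`-world (i.e. ¬∃ u v with `relc`, both ¬φ). -/
def satM (M : KFrame) : M.S → FormM → Prop
  | _, FormM.top => True
  | s, FormM.atom p => M.val s p
  | s, FormM.neg φ => ¬ satM M s φ
  | s, FormM.and φ ψ => satM M s φ ∧ satM M s ψ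
  | s, FormM.box i φ => ∀ t, M.rel i s t → satM M t φ
  | s, FormM.boxc i c φ => ∀ t u, M.relc i c s t u → satM M t φ ∨ satM M u φ

/-- Uniform substitution of `χ` for the atom `p`. -/
def FormM.subst (p : ℕ) (χ : FormM) : FormM → FormM
  | .top => .top
  | .atom q => if q = p then χ else .atom q
  | .neg φ => .neg (FormM.subst p χ φ)
  | .and φ ψ => .and (FormM.subst p χ φ) (FormM.subst p χ ψ)
  | .box i φ => .box i (FormM.subst p χ φ)
  | .boxc i c φ => .boxc i c (FormM.subst p χ φ)

/-- `ReplM ψ χ φ φ'`: `φ'` is obtained from `φ` by replacing some occurrences of `ψ` by `χ`. -/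
inductive ReplM (ψ χ : FormM) : FormM → FormM → Prop
  | base : ReplM ψ χ ψ χ
  | refl (φ : FormM) : ReplM ψ χ φ φ
  | neg {φ φ'} : ReplM ψ χ φ φ' → ReplM ψ χ (.neg φ) (.neg φ')
  | and {φ₁ φ₁' φ₂ φ₂'} : ReplM ψ χ φ₁ φ₁' → ReplM ψ χ φ₂ φ₂' →
      ReplM ψ χ (.and φ₁ φ₂) (.and φ₁' φ₂')
  | box (i) {φ φ'} : ReplM ψ χ φ φ' → ReplM ψ χ (.box i φ) (.box i φ')
  | boxc (i c) {φ φ'} : ReplM ψ χ φ φ' → ReplM ψ χ (.boxc i c φ) (.boxc i c φ')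

/-- `φ` is an instance of a propositional tautology: every Boolean valuation of formulas
respecting ⊤, ¬ and ∧ makes it true. -/
def TautM (φ : FormM) : Prop :=
  ∀ v : FormM → Bool, v .top = true → (∀ ψ, v (.neg ψ) = !v ψ) →
    (∀ ψ χ, v (.and ψ χ) = (v ψ && v χ)) → v φ = true

/-- The proof system SMLKV^r: TAUT, DISTK, DISTKv^r, Kv^r∨, with rules MP,
necessitation for □_i and □_i^c, uniform substitution, and replacement of equivalents. -/
inductive ProvM : FormM → Prop
  | taut {φ} : TautM φ → ProvM φ
  | distK (i : ℕ) (φ ψ : FormM) :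
      ProvM (.imp (.box i (.imp φ ψ)) (.imp (.box i φ) (.box i ψ)))
  | distKv (i c : ℕ) (φ ψ : FormM) :
      ProvM (.imp (.box i (.imp φ ψ)) (.imp (.boxc i c φ) (.boxc i c ψ)))
  | kvOr (i c : ℕ) (φ ψ : FormM) :
      ProvM (.imp (.and (.dia i (.and φ ψ)) (.diac i c (.or φ ψ)))
        (.or (.diac i c φ) (.diac i c ψ)))
  | mp {φ ψ} : ProvM (.imp φ ψ) → ProvM φ → ProvM ψ
  | necK (i : ℕ) {φ} : ProvM φ → ProvM (.box i φ)
  | necKv (i c : ℕ) {φ} : ProvM φ → ProvM (.boxc i c φ)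
  | subst (p : ℕ) (χ : FormM) {φ} : ProvM φ → ProvM (FormM.subst p χ φ)
  | re {ψ χ φ φ'} : ProvM (.iff ψ χ) → ReplM ψ χ φ φ' → ProvM (.iff φ φ')

/-- Conjunction of a finite list of formulas. -/
def conjM (L : List FormM) : FormM := L.foldr FormM.and FormM.top

/-- `φ` is derivable from `Γ` in SMLKV^r. -/
def ProvFromM (Γ : Set FormM) (φ : FormM) : Prop :=
  ∃ L : List FormM, (∀ ψ ∈ L, ψ ∈ Γ) ∧ ProvM (.imp (conjM L) φ)

/-- `Γ` is SMLKV^r-consistent. -/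
def ConsistentM (Γ : Set FormM) : Prop := ¬ ProvFromM Γ .bot

/-- `s` is a maximal SMLKV^r-consistent set. -/
def MCSM (s : Set FormM) : Prop :=
  ConsistentM s ∧ ∀ φ ∉ s, ¬ ConsistentM (insert φ s)

/-- Canonical binary relation: `s →_i t` iff `{φ : □_i φ ∈ s} ⊆ t`. -/
def canRel (i : ℕ) (s t : Set FormM) : Prop := ∀ φ, FormM.box i φ ∈ s → φ ∈ t

/-- Canonical ternary relation: `s R_i^c t u` iff `{φ : □_i φ ∈ s} ⊆ t ∩ u` and
`{ψ : □_i^c ψ ∈ s} ⊆ t ∪ u`. -/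
def canRelc (i c : ℕ) (s t u : Set FormM) : Prop :=
  (∀ φ, FormM.box i φ ∈ s → φ ∈ t ∧ φ ∈ u) ∧
  (∀ ψ, FormM.boxc i c ψ ∈ s → ψ ∈ t ∨ ψ ∈ u)

/-- The canonical model of SMLKV^r. -/
def canModelM : KFrame where
  S := {s : Set FormM // MCSM s}
  rel := fun i s t => canRel i s.val t.val
  relc := fun i c s t u => canRelc i c s.val t.val u.val
  val := fun s p => FormM.atom p ∈ s.val

namespace ProvFromM

variable {Γ Δ : Set FormM} {φ ψ : FormM}

lemma valuation_conjM {v : FormM → Bool} (ht : v .top = true)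
    (ha : ∀ ψ χ, v (.and ψ χ) = (v ψ && v χ)) (L : List FormM) :
    v (conjM L) = true ↔ ∀ ψ ∈ L, v ψ = true := by
  induction L with
  | nil => simpa [conjM] using ht
  | cons a L ih =>
    have h : v (conjM (a :: L)) = (v a && v (conjM L)) := ha a (conjM L)
    simp [h, ih]

lemma valuation_imp {v : FormM → Bool} (hn : ∀ ψ, v (.neg ψ) = !v ψ)
    (ha : ∀ ψ χ, v (.and ψ χ) = (v ψ && v χ)) (φ ψ : FormM) :
    v (.imp φ ψ) = true ↔ (v φ = true → v ψ = true) := by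
  simp only [FormM.imp, hn, ha]
  cases v φ <;> cases v ψ <;> simp

lemma of_prov (h : ProvM φ) : ProvFromM Γ φ := by
  refine ⟨[], by simp, .mp (.taut ?_) h⟩
  intro v _ hn ha
  simp only [valuation_imp hn ha]
  tauto

lemma of_taut (h : TautM φ) : ProvFromM Γ φ := of_prov (.taut h)

lemma of_mem (h : φ ∈ Γ) : ProvFromM Γ φ := by
  refine ⟨[φ], by simpa using h, .taut ?_⟩
  intro v ht hn ha
  simp [valuation_imp hn ha, valuation_conjM ht ha]

lemma mp (h₁ : ProvFromM Γ (.imp φ ψ)) (h₂ : ProvFromM Γ φ) : ProvFromM Γ ψ := by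
  obtain ⟨L₁, hL₁, p₁⟩ := h₁
  obtain ⟨L₂, hL₂, p₂⟩ := h₂
  refine ⟨L₁ ++ L₂, ?_, .mp (.mp (.taut ?_) p₁) p₂⟩
  · intro χ hχ
    rcases List.mem_append.1 hχ with h | h
    exacts [hL₁ χ h, hL₂ χ h]
  · intro v ht hn ha
    simp only [valuation_imp hn ha, valuation_conjM ht ha, List.mem_append]
    intro h₁ h₂ h
    exact h₁ (fun χ hχ => h χ (.inl hχ)) (h₂ fun χ hχ => h χ (.inr hχ))

lemma deduction (h : ProvFromM (insert φ Γ) ψ) : ProvFromM Γ (.imp φ ψ) := by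
  classical
  obtain ⟨L, hL, p⟩ := h
  refine ⟨L.filter (· ≠ φ), ?_, .mp (.taut ?_) p⟩
  · intro χ hχ
    simp only [List.mem_filter, decide_eq_true_eq] at hχ
    exact (hL χ hχ.1).resolve_left hχ.2
  · intro v ht hn ha
    simp only [valuation_imp hn ha, valuation_conjM ht ha, List.mem_filter, decide_eq_true_eq]
    intro h₁ h₂ h₃
    refine h₁ fun χ hχ => ?_
    by_cases e : χ = φ
    · rwa [e]
    · exact h₂ χ ⟨hχ, e⟩

lemma of_not_consistentM_insert_neg (h : ¬ ConsistentM (insert (.neg φ) Γ)) :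
    ProvFromM Γ φ := by
  refine mp (of_taut ?_) (deduction (not_not.1 h))
  intro v ht hn ha
  simp only [valuation_imp hn ha, FormM.bot, hn, ht]
  cases v φ <;> simp

end ProvFromM

/-- Lindenbaum's lemma. -/
lemma ConsistentM.exists_MCSM {Γ : Set FormM} (h : ConsistentM Γ) : ∃ s, MCSM s ∧ Γ ⊆ s := by
  obtain ⟨s, hΓs, hs⟩ := zorn_subset_nonempty {Δ | ConsistentM Δ} (by
    intro C hC hchain hne
    refine ⟨⋃₀ C, ?_, fun Δ hΔ => Set.subset_sUnion_of_mem hΔ⟩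
    rintro ⟨L, hL, p⟩
    have key : ∃ Δ ∈ C, ∀ ψ ∈ L, ψ ∈ Δ := by
      clear p
      induction L with
      | nil => exact ⟨hne.some, hne.some_mem, by simp⟩
      | cons a L ih =>
        obtain ⟨Δ₁, h₁, hL₁⟩ := ih fun ψ hψ => hL ψ (List.mem_cons_of_mem _ hψ)
        obtain ⟨Δ₂, h₂, ha⟩ := hL a List.mem_cons_self
        rcases hchain.total h₁ h₂ with hle | hle
        · exact ⟨Δ₂, h₂, by simpa using ⟨ha, fun ψ hψ => hle (hL₁ ψ hψ)⟩⟩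
        · exact ⟨Δ₁, h₁, by simpa using ⟨hle ha, hL₁⟩⟩
    obtain ⟨Δ, hΔ, hLΔ⟩ := key
    exact hC hΔ ⟨L, hLΔ, p⟩) Γ h
  refine ⟨s, ⟨hs.prop, fun φ hφ hcon => hφ ?_⟩, hΓs⟩
  exact hs.le_of_ge hcon (Set.subset_insert φ s) (Set.mem_insert φ s)

namespace MCSM

open ProvFromM

variable {s t : Set FormM} {φ ψ : FormM} {i c : ℕ}

lemma mem_of_provFromM (hs : MCSM s) (h : ProvFromM s φ) : φ ∈ s := by
  by_contra hφ
  exact hs.1 (mp (deduction (not_not.1 (hs.2 φ hφ))) h)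

lemma mem_of_prov (hs : MCSM s) (h : ProvM φ) : φ ∈ s := hs.mem_of_provFromM (of_prov h)

lemma mem_mp (hs : MCSM s) (h₁ : FormM.imp φ ψ ∈ s) (h₂ : φ ∈ s) : ψ ∈ s :=
  hs.mem_of_provFromM (mp (of_mem h₁) (of_mem h₂))

lemma neg_mem_iff (hs : MCSM s) : FormM.neg φ ∈ s ↔ φ ∉ s := by
  constructor
  · intro h₁ h₂
    refine hs.1 (mp (mp (of_taut ?_) (of_mem h₁)) (of_mem h₂))
    intro v ht hn ha
    simp only [valuation_imp hn ha, hn]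
    cases v φ <;> simp
  · intro h
    refine hs.mem_of_provFromM (mp (of_taut ?_) (deduction (not_not.1 (hs.2 φ h))))
    intro v ht hn ha
    simp only [valuation_imp hn ha, FormM.bot, hn, ht]
    cases v φ <;> simp

lemma and_mem_iff (hs : MCSM s) : FormM.and φ ψ ∈ s ↔ φ ∈ s ∧ ψ ∈ s := by
  refine ⟨fun h => ⟨?_, ?_⟩, fun h => ?_⟩
  · refine hs.mem_of_provFromM (mp (of_taut ?_) (of_mem h))
    intro v ht hn ha
    simp only [valuation_imp hn ha, ha, Bool.and_eq_true]
    tauto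
  · refine hs.mem_of_provFromM (mp (of_taut ?_) (of_mem h))
    intro v ht hn ha
    simp only [valuation_imp hn ha, ha, Bool.and_eq_true]
    tauto
  · refine hs.mem_of_provFromM (mp (mp (of_taut ?_) (of_mem h.1)) (of_mem h.2))
    intro v ht hn ha
    simp only [valuation_imp hn ha, ha, Bool.and_eq_true]
    tauto

lemma or_mem_iff (hs : MCSM s) : FormM.or φ ψ ∈ s ↔ φ ∈ s ∨ ψ ∈ s := by
  simp only [FormM.or, hs.neg_mem_iff, hs.and_mem_iff]
  tauto

lemma top_mem (hs : MCSM s) : FormM.top ∈ s :=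
  hs.mem_of_prov (.taut fun _ ht _ _ => ht)

lemma conjM_mem_iff (hs : MCSM s) (L : List FormM) : conjM L ∈ s ↔ ∀ ψ ∈ L, ψ ∈ s := by
  induction L with
  | nil => simpa [conjM] using hs.top_mem
  | cons a L ih =>
    have h : conjM (a :: L) = .and a (conjM L) := rfl
    simp [h, hs.and_mem_iff, ih]

lemma box_mp (hs : MCSM s) (h₁ : FormM.box i (.imp φ ψ) ∈ s) (h₂ : FormM.box i φ ∈ s) :
    FormM.box i ψ ∈ s :=
  hs.mem_mp (hs.mem_mp (hs.mem_of_prov (.distK i φ ψ)) h₁) h₂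

lemma boxc_mp (hs : MCSM s) (h₁ : FormM.box i (.imp φ ψ) ∈ s) (h₂ : FormM.boxc i c φ ∈ s) :
    FormM.boxc i c ψ ∈ s :=
  hs.mem_mp (hs.mem_mp (hs.mem_of_prov (.distKv i c φ ψ)) h₁) h₂

lemma box_mono (hs : MCSM s) (h₁ : ProvM (.imp φ ψ)) (h₂ : FormM.box i φ ∈ s) :
    FormM.box i ψ ∈ s :=
  hs.box_mp (hs.mem_of_prov (.necK i h₁)) h₂

lemma boxc_mono (hs : MCSM s) (h₁ : ProvM (.imp φ ψ)) (h₂ : FormM.boxc i c φ ∈ s) :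
    FormM.boxc i c ψ ∈ s :=
  hs.boxc_mp (hs.mem_of_prov (.necK i h₁)) h₂

lemma provM_imp_and (φ ψ : FormM) : ProvM (.imp φ (.imp ψ (.and φ ψ))) := by
  refine .taut ?_
  intro v ht hn ha
  simp only [valuation_imp hn ha, ha, Bool.and_eq_true]
  tauto

lemma provM_imp_and_swap (φ ψ : FormM) : ProvM (.imp ψ (.imp φ (.and φ ψ))) := by
  refine .taut ?_
  intro v ht hn ha
  simp only [valuation_imp hn ha, ha, Bool.and_eq_true]
  tauto

lemma box_conjM_mem (hs : MCSM s) (L : List FormM) (hL : ∀ ψ ∈ L, FormM.box i ψ ∈ s) :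
    FormM.box i (conjM L) ∈ s := by
  induction L with
  | nil => exact hs.mem_of_prov (.necK i (.taut fun _ ht _ _ => ht))
  | cons a L ih =>
    have h := ih fun ψ hψ => hL ψ (List.mem_cons_of_mem _ hψ)
    exact hs.box_mp (hs.box_mono (provM_imp_and a (conjM L)) (hL a List.mem_cons_self)) h

lemma box_mem_of_provFromM (hs : MCSM s) (h : ProvFromM {ψ | FormM.box i ψ ∈ s} φ) :
    FormM.box i φ ∈ s := by
  obtain ⟨L, hL, p⟩ := h
  exact hs.box_mono p (hs.box_conjM_mem L hL)

lemma exists_canRel_of_box_notMem (hs : MCSM s) (h : FormM.box i φ ∉ s) :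
    ∃ t, MCSM t ∧ canRel i s t ∧ φ ∉ t := by
  have hcon : ConsistentM (insert (.neg φ) {ψ | FormM.box i ψ ∈ s}) := by
    by_contra hc
    exact h (hs.box_mem_of_provFromM (of_not_consistentM_insert_neg hc))
  obtain ⟨t, ht, hsub⟩ := hcon.exists_MCSM
  exact ⟨t, ht, fun ψ hψ => hsub (.inr hψ), ht.neg_mem_iff.1 (hsub (.inl rfl))⟩

/-- The dual form of the axiom Kv^r∨. -/
lemma boxc_and_mem (hs : MCSM s) (ht : MCSM t) (hst : canRel i s t) (hφt : φ ∉ t) (hψt : ψ ∉ t)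
    (hφ : FormM.boxc i c φ ∈ s) (hψ : FormM.boxc i c ψ ∈ s) :
    FormM.boxc i c (.and φ ψ) ∈ s := by
  by_contra hcon
  have hdn : ∀ χ, ProvM (.imp χ (.neg (.neg χ))) := by
    intro χ
    refine .taut ?_
    intro v _ hn ha
    simp only [valuation_imp hn ha, hn]
    cases v χ <;> simp
  have hdia : FormM.dia i (.and (.neg φ) (.neg ψ)) ∈ s := by
    refine hs.neg_mem_iff.2 fun h => ?_
    refine ht.neg_mem_iff.1 (hst _ h) (ht.and_mem_iff.2 ?_)
    exact ⟨ht.neg_mem_iff.2 hφt, ht.neg_mem_iff.2 hψt⟩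
  have hdiac : FormM.diac i c (.or (.neg φ) (.neg ψ)) ∈ s := by
    refine hs.neg_mem_iff.2 fun h => hcon (hs.boxc_mono (.taut ?_) h)
    intro v _ hn ha
    simp only [valuation_imp hn ha, FormM.or, hn, ha]
    cases v φ <;> cases v ψ <;> simp
  have hor := hs.mem_mp (hs.mem_of_prov (.kvOr i c (.neg φ) (.neg ψ)))
    (hs.and_mem_iff.2 ⟨hdia, hdiac⟩)
  rcases hs.or_mem_iff.1 hor with h | h
  · exact hs.neg_mem_iff.1 h (hs.boxc_mono (hdn φ) hφ)
  · exact hs.neg_mem_iff.1 h (hs.boxc_mono (hdn ψ) hψ)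

lemma boxc_conjM_mem (hs : MCSM s) (ht : MCSM t) (hst : canRel i s t) (L : List FormM)
    (hL : ∀ ψ ∈ L, FormM.box i ψ ∈ s ∨ FormM.boxc i c ψ ∈ s ∧ ψ ∉ t) :
    FormM.boxc i c (conjM L) ∈ s := by
  induction L with
  | nil => exact hs.mem_of_prov (.necKv i c (.taut fun _ ht _ _ => ht))
  | cons a L ih =>
    have hL' := fun ψ hψ => hL ψ (List.mem_cons_of_mem a hψ)
    rcases hL a List.mem_cons_self with ha | ⟨ha, hat⟩
    · exact hs.boxc_mp (hs.box_mono (provM_imp_and a (conjM L)) ha) (ih hL')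
    by_cases hLt : conjM L ∈ t
    · have hbox : FormM.box i (conjM L) ∈ s := hs.box_conjM_mem L fun ψ hψ =>
        (hL' ψ hψ).resolve_right fun h => h.2 ((ht.conjM_mem_iff L).1 hLt ψ hψ)
      exact hs.boxc_mp (hs.box_mono (provM_imp_and_swap a (conjM L)) hbox) ha
    · exact hs.boxc_and_mem ht hst hat hLt ha (ih hL')

lemma exists_canRelc_of_boxc_notMem (hs : MCSM s) (h : FormM.boxc i c φ ∉ s) :
    ∃ t u, MCSM t ∧ MCSM u ∧ canRelc i c s t u ∧ φ ∉ t ∧ φ ∉ u := by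
  have hbox : FormM.box i φ ∉ s := fun hb => h <| by
    refine hs.boxc_mp (φ := .top) (hs.box_mono (.taut ?_) hb)
      (hs.mem_of_prov (.necKv i c (.taut fun _ ht _ _ => ht)))
    intro v _ hn ha
    simp only [valuation_imp hn ha]
    tauto
  obtain ⟨t, ht, hst, hφt⟩ := hs.exists_canRel_of_box_notMem hbox
  have hcon : ConsistentM
      (insert (.neg φ) {ψ | FormM.box i ψ ∈ s ∨ FormM.boxc i c ψ ∈ s ∧ ψ ∉ t}) := by
    by_contra hc
    obtain ⟨L, hL, p⟩ := of_not_consistentM_insert_neg hc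
    exact h (hs.boxc_mono p (hs.boxc_conjM_mem ht hst L hL))
  obtain ⟨u, hu, hsub⟩ := hcon.exists_MCSM
  refine ⟨t, u, ht, hu, ⟨fun ψ hψ => ⟨hst ψ hψ, hsub (.inr (.inl hψ))⟩, fun ψ hψ => ?_⟩,
    hφt, hu.neg_mem_iff.1 (hsub (.inl rfl))⟩
  by_cases hψt : ψ ∈ t
  · exact .inl hψt
  · exact .inr (hsub (.inr (.inr ⟨hψ, hψt⟩)))

end MCSM

/-- truth lemma for SMLKV^r: truth at a state of the canonical model
coincides with membership. -/
theorem stmt7 : ∀ (s : canModelM.S) (φ : FormM), satM canModelM s φ ↔ φ ∈ s.val := by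
  intro s φ
  induction φ generalizing s with
  | top => exact iff_of_true trivial s.property.top_mem
  | atom p => exact Iff.rfl
  | neg φ ih => exact (not_congr (ih s)).trans s.property.neg_mem_iff.symm
  | and φ ψ ih₁ ih₂ => exact (and_congr (ih₁ s) (ih₂ s)).trans s.property.and_mem_iff.symm
  | box i φ ih =>
    constructor
    · intro h
      by_contra hbox
      obtain ⟨t, ht, hst, hφt⟩ := s.property.exists_canRel_of_box_notMem hbox
      exact hφt ((ih ⟨t, ht⟩).1 (h ⟨t, ht⟩ hst))
    · exact fun h t hst => (ih t).2 (hst φ h)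
  | boxc i c φ ih =>
    constructor
    · intro h
      by_contra hbox
      obtain ⟨t, u, ht, hu, hstu, hφt, hφu⟩ := s.property.exists_canRelc_of_boxc_notMem hbox
      rcases h ⟨t, ht⟩ ⟨u, hu⟩ hstu with h' | h'
      · exact hφt ((ih ⟨t, ht⟩).1 h')
      · exact hφu ((ih ⟨u, hu⟩).1 h')
    · exact fun h t u hstu => (hstu.2 φ h).imp (ih t).2 (ih u).2
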